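/- Let α, β, γ, δ ∈ ℂ be algebraically independent over ℚ. Let L be a differential field extension of ℂ(t) with derivation D, K a differential subfield of L, and let y ∈ L with y ≠ 0 satisfy the third Painlevé equation y'' = (1/y)(y')² − (1/t)y' + (1/t)(αy² + β) + γy³ + δ/y. Then either y is algebraic over K, or y and y' are algebraically independent over K. (Strong minimality of generic P_III; part of the paper's main result for the family P_III.) -/

import Mathlib

section Helpers

open Polynomial

/-- The additive map on `R[X]` that applies `d` to every coefficient. -/
noncomputable def coeffDer {R : Type*} [CommRing R] (d : R →+ R) : R[X] →+ R[X] where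
  toFun p := ∑ i ∈ p.support, monomial i (d (p.coeff i))
  map_zero' := by simp
  map_add' p q := by
    have key : ∀ (f : R[X]) (i : ℕ),
        (∑ i ∈ f.support, monomial i (d (f.coeff i))).coeff i = d (f.coeff i) := fun f i => by
      simp only [finsetSum_coeff, coeff_monomial, Finset.sum_ite_eq', mem_support_iff]
      by_cases h : f.coeff i = 0 <;> simp [h]
    ext i
    rw [coeff_add, key, key, key, coeff_add, map_add]

section CoeffDer

variable {R : Type*} [CommRing R] (d : R →+ R)

@[simp]
lemma coeff_coeffDer (p : R[X]) (i : ℕ) : (coeffDer d p).coeff i = d (p.coeff i) := by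
  simp only [coeffDer, AddMonoidHom.coe_mk, ZeroHom.coe_mk, finsetSum_coeff, coeff_monomial,
    Finset.sum_ite_eq', mem_support_iff]
  by_cases h : p.coeff i = 0 <;> simp [h]

@[simp]
lemma coeffDer_C (a : R) : coeffDer d (C a) = C (d a) := by
  ext i; simp [coeff_C, apply_ite d]

lemma coeffDer_X_pow (h1 : d 1 = 0) (k : ℕ) : coeffDer d (X ^ k : R[X]) = 0 := by
  ext i; simp [coeff_X_pow, apply_ite d, h1]

lemma coeffDer_X (h1 : d 1 = 0) : coeffDer d (X : R[X]) = 0 := by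
  simpa using coeffDer_X_pow d h1 1

lemma coeffDer_C_mul_X (a : R) : coeffDer d (C a * X) = C (d a) * X := by
  ext i; simp [coeff_X, apply_ite d]

lemma coeffDer_mul (hd : ∀ a b, d (a * b) = a * d b + d a * b) (p q : R[X]) :
    coeffDer d (p * q) = p * coeffDer d q + coeffDer d p * q := by
  ext i
  simp [coeff_mul, map_sum, hd, Finset.sum_add_distrib]

lemma derivative_coeffDer (p : R[X]) :
    derivative (coeffDer d p) = coeffDer d (derivative p) := by
  ext i
  have h := map_nsmul d (i + 1) (p.coeff (i + 1))
  simp only [nsmul_eq_mul, Nat.cast_add, Nat.cast_one] at h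
  simp [coeff_derivative, mul_comm _ ((i : R) + 1), h]

lemma natDegree_coeffDer_le (p : R[X]) : (coeffDer d p).natDegree ≤ p.natDegree :=
  natDegree_le_iff_coeff_eq_zero.2 fun i hi => by simp [coeff_eq_zero_of_natDegree_lt hi]

lemma coeffDer_coeff_natDegree_of_monic (h1 : d 1 = 0) {p : R[X]} (hp : p.Monic) :
    (coeffDer d p).coeff p.natDegree = 0 := by
  simp [hp.coeff_natDegree, h1]

end CoeffDer

section OneVariable

/-- `d/dy` on `K[y]`, as an additive map. -/
noncomputable def derivY (K : Type*) [Field K] : K[X] →+ K[X] :=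
  (derivative : K[X] →ₗ[K] K[X]).toAddMonoidHom

@[simp]
lemma derivY_apply {K : Type*} [Field K] (p : K[X]) : derivY K p = derivative p := rfl

lemma derivY_mul {K : Type*} [Field K] (p q : K[X]) :
    derivY K (p * q) = p * derivY K q + derivY K p * q := by
  simp only [derivY_apply, derivative_mul]; ring

variable {K : Type*} [Field K] [CharZero K]

lemma coeff_one_eq_natDegree {f g : K[X]} {c : K} (hf : f ≠ 0) (hg : g.natDegree ≤ 1)
    (h : (X ^ 2 + C c) * derivative f = g * f) : g.coeff 1 = f.natDegree := by
  have h1 : (g * f).coeff (1 + f.natDegree) = g.coeff 1 * f.coeff f.natDegree :=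
    coeff_mul_add_eq_of_natDegree_le hg le_rfl
  have h2 : ((X ^ 2 + C c) * derivative f).coeff (1 + f.natDegree)
      = f.natDegree * f.coeff f.natDegree := by
    rw [add_mul, coeff_add, coeff_C_mul, coeff_derivative, X_pow_mul, coeff_mul_X_pow']
    rw [coeff_eq_zero_of_natDegree_lt (by omega : f.natDegree < 1 + f.natDegree + 1)]
    rcases Nat.eq_zero_or_pos f.natDegree with h0 | h0
    · simp [h0]
    · rw [if_pos (by omega), coeff_derivative,
        show 1 + f.natDegree - 2 + 1 = f.natDegree by omega,
        show ((1 + f.natDegree - 2 : ℕ) : K) + 1 = f.natDegree by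
          exact_mod_cast (by omega : 1 + f.natDegree - 2 + 1 = f.natDegree)]
      ring
  rw [h, h1] at h2
  exact mul_right_cancel₀ (by simpa using hf) h2

lemma mul_rootMultiplicity_eq_eval {f A B : K[X]} {h : K} (hf : f ≠ 0)
    (e : (X - C h) * A * derivative f = B * f) :
    A.eval h * f.rootMultiplicity h = B.eval h := by
  obtain ⟨u, hu, hdvd⟩ := f.exists_eq_pow_rootMultiplicity_mul_and_not_dvd hf h
  set k := f.rootMultiplicity h
  have hu0 : u.eval h ≠ 0 := fun h0 => hdvd (dvd_iff_isRoot.2 h0)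
  have hd : (X - C h) * derivative f
      = (X - C h) ^ k * ((k : K[X]) * u + (X - C h) * derivative u) := by
    rw [hu]
    cases k with
    | zero => simp
    | succ k => simp [derivative_mul, derivative_X_sub_C_pow]; ring
  have e' : (X - C h) ^ k * (A * ((k : K[X]) * u + (X - C h) * derivative u))
      = (X - C h) ^ k * (B * u) := by
    linear_combination e - A * hd + B * hu
  have e2 := congrArg (eval h) (mul_left_cancel₀ (pow_ne_zero _ (X_sub_C_ne_zero h)) e')
  simp at e2
  refine mul_right_cancel₀ hu0 ?_
  linear_combination e2

end OneVariable

section Bivariate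

variable {K : Type*} [Field K] [CharZero K]

/-- Coefficients of degree one past the top in the invariance equation of a bivariate polynomial. -/
lemma cofactor_natDegree_le_and_coeff {P G E : K[X][X]} {s : K} {R : K[X]}
    (hP : P ≠ 0) (hE : E.natDegree ≤ P.natDegree)
    (h : C X * E + C X * X * coeffDer (derivY K) P
      + (X ^ 2 - C (C s * X) * X + C R) * derivative P = G * P) :
    G.natDegree ≤ 1 ∧ X * derivative P.leadingCoeff
      + (P.natDegree : K[X]) * P.leadingCoeff = G.coeff 1 * P.leadingCoeff := by
  set n := P.natDegree with hn
  have hY : (coeffDer (derivY K) P).natDegree ≤ n := natDegree_coeffDer_le _ _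
  have hd : (derivative P).natDegree ≤ n - 1 := natDegree_derivative_le P
  have hX : (C X * X * coeffDer (derivY K) P).natDegree ≤ 1 + n :=
    natDegree_mul_le_of_le ((natDegree_C_mul_le _ _).trans natDegree_X_le) hY
  have hEE : (C X * E).natDegree ≤ 1 + n :=
    (natDegree_C_mul_le _ _).trans (hE.trans (by omega))
  have hq : (X ^ 2 - C (C s * X) * X + C R : K[X][X]).natDegree ≤ 2 := by
    compute_degree
  have hqd : ((X ^ 2 - C (C s * X) * X + C R) * derivative P).natDegree ≤ 1 + n := by
    rcases Nat.eq_zero_or_pos n with h0 | h0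
    · rw [derivative_of_natDegree_zero h0, mul_zero]; simp
    · exact (natDegree_mul_le_of_le hq hd).trans (by omega)
  have htot : (G * P).natDegree ≤ 1 + n := by
    rw [← h]
    exact natDegree_add_le_of_degree_le (natDegree_add_le_of_degree_le hEE hX) hqd
  have hG : G.natDegree ≤ 1 := by
    by_cases hG0 : G = 0
    · simp [hG0]
    · rw [natDegree_mul hG0 hP] at htot; omega
  refine ⟨hG, ?_⟩
  have h1 : (G * P).coeff (1 + n) = G.coeff 1 * P.coeff n :=
    coeff_mul_add_eq_of_natDegree_le hG le_rfl
  rw [← h, coeff_add, coeff_add, coeff_C_mul,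
    coeff_eq_zero_of_natDegree_lt (by omega : E.natDegree < 1 + n), mul_assoc, coeff_C_mul,
    add_comm 1 n, coeff_X_mul, coeff_coeffDer, add_mul, sub_mul, coeff_add, coeff_sub, coeff_C_mul,
    mul_assoc, coeff_C_mul, coeff_X_mul, coeff_derivative, coeff_derivative, X_pow_mul,
    coeff_mul_X_pow', coeff_eq_zero_of_natDegree_lt (by omega : P.natDegree < n + 1),
    coeff_eq_zero_of_natDegree_lt (by omega : P.natDegree < n + 1 + 1)] at h1
  rw [leadingCoeff, ← hn, ← h1]
  rcases Nat.eq_zero_or_pos n with h0 | h0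
  · simp [h0]
  · rw [if_pos (by omega), coeff_derivative, show n + 1 - 2 + 1 = n by omega,
      show ((n + 1 - 2 : ℕ) : K[X]) + 1 = n by exact_mod_cast (by omega : n + 1 - 2 + 1 = n)]
    rw [derivY_apply]
    ring

lemma exists_leadingCoeff_eq_C {P G E : K[X][X]} {s : K} {R : K[X]}
    (hP : P.IsPrimitive) (hE : E.natDegree ≤ P.natDegree)
    (h : C X * E + C X * X * coeffDer (derivY K) P
      + (X ^ 2 - C (C s * X) * X + C R) * derivative P = G * P) :
    ∃ q : K, q ≠ 0 ∧ P.leadingCoeff = C q := by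
  have hP0 : P ≠ 0 := hP.ne_zero
  obtain ⟨hG, hlead⟩ := cofactor_natDegree_le_and_coeff hP0 hE h
  set ev : K[X] →+* K := evalRingHom 0
  have hQ0 : P.map ev ≠ 0 := by
    intro h0
    have hdvd : C (X : K[X]) ∣ P := by
      rw [C_dvd_iff_dvd_coeff]
      intro i
      rw [X_dvd_iff, coeff_zero_eq_eval_zero]
      simpa [ev] using congrArg (fun f => f.coeff i) h0
    exact not_isUnit_X (hP _ hdvd)
  have hQ : (X ^ 2 + C (R.eval 0)) * derivative (P.map ev) = G.map ev * P.map ev := by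
    have := congrArg (Polynomial.map ev) h
    simpa [derivative_map, ev] using this
  have he : (G.coeff 1).eval 0 = (P.map ev).natDegree := by
    have := coeff_one_eq_natDegree hQ0 (natDegree_map_le.trans hG) hQ
    simpa [ev] using this
  have hle : (P.map ev).natDegree ≤ P.natDegree := natDegree_map_le
  set e := (P.map ev).natDegree
  set n := P.natDegree
  set p := P.leadingCoeff
  have hp : p ≠ 0 := leadingCoeff_ne_zero.2 hP0
  have hmul : X * derivative p = (G.coeff 1 - (n : K[X])) * p := by
    linear_combination hlead
  have hdeg : (G.coeff 1 - (n : K[X])).natDegree = 0 := by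
    by_cases h0 : G.coeff 1 - (n : K[X]) = 0
    · simp [h0]
    have h1 := natDegree_mul h0 hp
    rw [← hmul] at h1
    have h2 : (X * derivative p).natDegree ≤ p.natDegree := by
      rcases Nat.eq_zero_or_pos p.natDegree with h3 | h3
      · rw [derivative_of_natDegree_zero h3]; simp
      · exact (natDegree_mul_le_of_le natDegree_X_le (natDegree_derivative_le p)).trans (by omega)
    omega
  have hconst : G.coeff 1 - (n : K[X]) = C ((e : K) - n) := by
    rw [eq_C_of_natDegree_eq_zero hdeg, coeff_zero_eq_eval_zero]
    simp [he]
  have hpd : p.natDegree = 0 := by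
    have h1 := congrArg (fun f => f.coeff p.natDegree) hmul
    simp only [hconst, coeff_C_mul] at h1
    by_contra h0
    obtain ⟨m, hm⟩ := Nat.exists_eq_succ_of_ne_zero h0
    have hc : p.coeff p.natDegree ≠ 0 := by simpa using hp
    rw [hm, Nat.succ_eq_add_one, coeff_X_mul, coeff_derivative] at h1
    rw [hm, Nat.succ_eq_add_one] at hc
    have h2 : ((m : K) + 1) = (e : K) - n := mul_left_cancel₀ hc (by linear_combination h1)
    have h3 : m + 1 + n = e := by
      have : ((m + 1 + n : ℕ) : K) = e := by push_cast; linear_combination h2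
      exact_mod_cast this
    omega
  refine ⟨p.coeff 0, fun h0 => hp ?_, eq_C_of_natDegree_eq_zero hpd⟩
  rw [eq_C_of_natDegree_eq_zero hpd, h0, C_0]

/-- The trace computation: an invariant polynomial, monic in `z`, has the linear (in `y`) part
of its trace coefficient determined up to an integer. -/
lemma exists_coeff_one_eq {d : K →+ K} {P G : K[X][X]} {s η : K} {R : K[X]}
    (hd : ∀ a b, d (a * b) = a * d b + d a * b)
    (hP : P.Monic) (hn : 0 < P.natDegree) (hη : η ≠ 0) (hdη : d η = 0)
    (hR : R.coeff 0 = -η ^ 2)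
    (h : C X * coeffDer (coeffDer d) P + C X * X * coeffDer (derivY K) P
      + (X ^ 2 - C (C s * X) * X + C R) * derivative P = G * P) :
    ∃ M : ℤ, (P.coeff (P.natDegree - 1)).coeff 1
      = M * (R.coeff 1 / η) - s * P.natDegree := by
  obtain ⟨hG, hlead⟩ := cofactor_natDegree_le_and_coeff hP.ne_zero (natDegree_coeffDer_le _ _) h
  rw [hP.leadingCoeff] at hlead
  simp only [derivative_one, mul_zero, mul_one, zero_add] at hlead
  set ev : K[X] →+* K := evalRingHom 0 with hev
  set n := P.natDegree with hnn
  set Q₀ := P.map ev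
  have hQm : Q₀.Monic := hP.map ev
  have hQdeg : Q₀.natDegree = n := hP.natDegree_map ev
  have hQ0 : Q₀ ≠ 0 := hQm.ne_zero
  set g₀ : K := (G.coeff 0).eval 0
  have hGform : G = C (n : K[X]) * X + C (G.coeff 0) := by
    rw [hlead]; exact eq_X_add_C_of_natDegree_le_one hG
  have hGev : G.map ev = C (n : K) * X + C g₀ := by
    rw [hGform]; simp [ev, g₀]
  have hR0 : R.eval 0 = -η ^ 2 := by rw [← coeff_zero_eq_eval_zero, hR]
  have e₁ : (X ^ 2 + C (-η ^ 2)) * derivative Q₀ = (C (n : K) * X + C g₀) * Q₀ := by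
    have := congrArg (Polynomial.map ev) h
    rw [← hR0, ← hGev]
    simpa [← derivative_map, Q₀, ev] using this
  have hd1 : d 1 = 0 := by simpa using hd 1 1
  have hdn : ∀ k : ℤ, d k = 0 := fun k => by
    have := map_zsmul d k 1
    simpa [hd1] using this
  -- the residue at `η` is an integer
  obtain ⟨a, ha⟩ : ∃ a : ℕ, 2 * η * a = n * η + g₀ := by
    have := mul_rootMultiplicity_eq_eval (f := Q₀) (A := X + C η) (B := C (n : K) * X + C g₀)
      (h := η) hQ0 (by rw [← e₁]; simp only [C_neg, C_pow]; ring)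
    refine ⟨Q₀.rootMultiplicity η, ?_⟩
    simp at this
    linear_combination this
  have hg₀ : g₀ = (((2 * a - n : ℤ)) : K) * η := by push_cast; linear_combination -ha
  have hdg₀ : d g₀ = 0 := by rw [hg₀, hd, hdη, hdn]; simp
  -- the coefficients of `Q₀` are constants
  have hdQ : coeffDer d Q₀ = 0 := by
    by_contra hne
    have e₂ : (X ^ 2 + C (-η ^ 2)) * derivative (coeffDer d Q₀)
        = (C (n : K) * X + C g₀) * coeffDer d Q₀ := by
      have := congrArg (coeffDer d) e₁
      have hdη2 : d (-η ^ 2) = 0 := by rw [map_neg, pow_two, hd, hdη]; simp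
      have hdnat : d (n : K) = 0 := by simpa using hdn n
      rw [coeffDer_mul d hd, coeffDer_mul d hd, map_add, map_add, coeffDer_X_pow d hd1, coeffDer_C,
        coeffDer_C, coeffDer_C_mul_X, hdη2, hdg₀, hdnat] at this
      rw [derivative_coeffDer]
      simpa using this
    have h1 := coeff_one_eq_natDegree hne (by compute_degree) e₂
    have h2 : n = (coeffDer d Q₀).natDegree := by simpa using h1
    have h3 := coeffDer_coeff_natDegree_of_monic d hd1 hQm
    rw [hQdeg, h2] at h3
    exact hne (leadingCoeff_eq_zero.1 h3)
  have hE : (coeffDer (coeffDer d) P).map ev = 0 := by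
    rw [← hdQ]
    ext i
    simp [ev, Q₀, ← coeff_zero_eq_eval_zero]
  -- the first order part
  set Q₁ := (coeffDer (derivY K) P).map ev with hQ₁
  set r := R.coeff 1
  set g₁ := (G.coeff 0).coeff 1
  have hder1 : ∀ f : K[X], (derivative f).eval 0 = f.coeff 1 := fun f => by
    rw [← coeff_zero_eq_eval_zero, coeff_derivative]; simp
  have hQ₁c : ∀ i, Q₁.coeff i = (P.coeff i).coeff 1 := fun i => by
    simp [Q₁, ev, hder1]
  have e₃ : X * Q₁ + (C (-s) * X + C r) * derivative Q₀ + (X ^ 2 + C (-η ^ 2)) * derivative Q₁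
      = C g₁ * Q₀ + (C (n : K) * X + C g₀) * Q₁ := by
    have h1 := congrArg (Polynomial.map ev) (congrArg (coeffDer (derivY K)) h)
    have hY1 : derivY K 1 = 0 := by simp
    have h2 : (coeffDer (derivY K) G).map ev = C g₁ := by
      rw [hGform, map_add, coeffDer_C_mul_X, coeffDer_C]
      simp [ev, hder1, g₁]
    rw [coeffDer_mul _ derivY_mul] at h1
    simp only [Polynomial.map_add, Polynomial.map_mul, h2, hGev] at h1
    rw [map_add, map_add, coeffDer_mul _ derivY_mul, coeffDer_mul _ derivY_mul,
      coeffDer_mul _ derivY_mul, coeffDer_mul _ derivY_mul, map_add, map_sub,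
      coeffDer_X_pow _ hY1, coeffDer_C, coeffDer_C_mul_X, ← derivative_coeffDer, coeffDer_C, coeffDer_X _ hY1] at h1
    simp only [Polynomial.map_add, Polynomial.map_mul, Polynomial.map_sub, Polynomial.map_C,
      Polynomial.map_X, Polynomial.map_pow, Polynomial.map_zero, ← derivative_map, hE] at h1
    simp [ev, hder1, hR0] at h1
    simp only [Q₀, Q₁, derivative_map, ev, r, C_neg, C_pow, map_natCast]
    linear_combination h1
  have hQn : ∀ i, n ≤ i → Q₁.coeff i = 0 := fun i hi => by
    rw [hQ₁c]
    rcases hi.eq_or_lt with rfl | hi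
    · rw [hnn, hP.coeff_natDegree, coeff_one]; simp
    · rw [coeff_eq_zero_of_natDegree_lt hi, coeff_zero]
  obtain ⟨m, hm⟩ : ∃ m, n = m + 1 := ⟨n - 1, by omega⟩
  have hQ₀n : Q₀.coeff (m + 1) = 1 := by
    rw [← hm, ← hQdeg]; exact hQm
  have hQ₀n' : Q₀.coeff (m + 1 + 1) = 0 := coeff_eq_zero_of_natDegree_lt (by omega)
  have hQ₁n : Q₁.coeff (m + 1) = 0 := hQn _ (by omega)
  have hQ₁n' : Q₁.coeff (m + 1 + 1) = 0 := hQn _ (by omega)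
  have hnc : (n : K) = m + 1 := by exact_mod_cast hm
  have hg₁ : g₁ = -(s * n) := by
    have h1 := congrArg (fun f => f.coeff (m + 1)) e₃
    have h2 : (X ^ 2 * derivative Q₁).coeff (m + 1) = m * Q₁.coeff m := by
      rw [X_pow_mul, coeff_mul_X_pow']
      rcases m with _ | k
      · simp
      · rw [if_pos (by omega), show k + 1 + 1 - 2 = k by omega, coeff_derivative]
        push_cast; ring
    simp only [add_mul, mul_assoc, coeff_add, coeff_X_mul, coeff_C_mul, coeff_derivative, h2,
      hQ₀n, hQ₀n', hQ₁n, hQ₁n', hnc] at h1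
    linear_combination -h1 + s * hnc
  set ρ : K := r * g₀ / η ^ 2 - s * n with hρ
  set σ : K := n * r - s * g₀ with hσ
  have hρη : C ρ * C η ^ 2 = C r * C g₀ - C s * C (n : K) * C η ^ 2 := by
    simp only [← C_mul, ← C_pow, ← C_sub]
    congr 1
    rw [hρ]; field_simp
  have hσC : C σ = C (n : K) * C r - C s * C g₀ := by
    simp only [← C_mul, ← C_sub, hσ]
  have hg₁C : C g₁ = -(C s * C (n : K)) := by simp only [← C_mul, ← C_neg, hg₁]
  set V := (X ^ 2 + C (-η ^ 2)) * Q₁ - (C ρ * X + C σ) * Q₀ with hV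
  have eV : (X ^ 2 + C (-η ^ 2)) * derivative V = ((C (n : K) + 1) * X + C g₀) * V := by
    have hVd : derivative V = 2 * X * Q₁ + (X ^ 2 + C (-η ^ 2)) * derivative Q₁
        - C ρ * Q₀ - (C ρ * X + C σ) * derivative Q₀ := by
      rw [hV]
      simp only [derivative_sub, derivative_mul, derivative_add, derivative_X_pow, derivative_C,
        derivative_X]
      simp only [Nat.cast_ofNat, map_ofNat]
      ring
    rw [hVd, hV]
    simp only [C_neg, C_pow] at e₁ e₃ ⊢
    rw [hg₁C] at e₃
    rw [hσC]
    linear_combination (X ^ 2 + -C η ^ 2) * e₃ + (-(C ρ * X + C (n : K) * C r - C s * C g₀)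
      + C s * X - C r) * e₁ + Q₀ * hρη
  have hV0 : V = 0 := by
    by_contra hne
    have h1 := mul_rootMultiplicity_eq_eval (f := V) (A := X + C η)
      (B := (C (n : K) + 1) * X + C g₀) (h := η) hne
      (by rw [← eV]; simp only [C_neg, C_pow]; ring)
    simp only [eval_add, eval_mul, eval_X, eval_C, eval_one] at h1
    have h2 : η * (2 * (V.rootMultiplicity η : K)) = η * (2 * a + 1) := by
      linear_combination h1 - ha
    have h3 := mul_left_cancel₀ hη h2
    have h4 : 2 * V.rootMultiplicity η = 2 * a + 1 := by exact_mod_cast h3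
    omega
  refine ⟨2 * a - n, ?_⟩
  have h1 := congrArg (fun f => f.coeff (m + 1 + 1)) hV0
  simp only [hV, add_mul, mul_assoc, coeff_add, coeff_sub, coeff_C_mul, coeff_X_mul, pow_two,
    hQ₁n', hQ₀n, hQ₀n', coeff_zero] at h1
  rw [hm, Nat.add_sub_cancel, ← hQ₁c, ← hm]
  have h2 : ρ = ((2 * a - n : ℤ) : K) * (r / η) - s * n := by
    rw [hρ, hg₀]; field_simp
  rw [← h2]
  linear_combination h1

end Bivariate

section Evaluation

variable {R L : Type*} [CommRing R] [Field L]

lemma additive_pow_of_leibniz {D : L →+ L} (hD : ∀ a b, D (a * b) = a * D b + D a * b)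
    (z : L) (k : ℕ) : D (z ^ (k + 1)) = (k + 1) * z ^ k * D z := by
  induction k with
  | zero => simp
  | succ k ih => rw [pow_succ, hD, ih]; push_cast; ring

lemma leibniz_eval₂ {D : L →+ L} (hD : ∀ a b, D (a * b) = a * D b + D a * b)
    (f : R →+* L) (d₁ d₂ : R →+ R) (w : L) (hf : ∀ r, D (f r) = f (d₁ r) + f (d₂ r) * w)
    (z : L) (P : R[X]) :
    D (eval₂ f z P) = eval₂ f z (coeffDer d₁ P) + eval₂ f z (coeffDer d₂ P) * w
      + eval₂ f z (derivative P) * D z := by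
  induction P using Polynomial.induction_on' with
  | add p q hp hq =>
    simp only [map_add, eval₂_add, hp, hq]
    ring
  | monomial n a =>
    have hmon : ∀ d : R →+ R, coeffDer d (monomial n a) = monomial n (d a) := fun d => by
      ext i; simp [coeff_monomial, apply_ite d]
    rw [hmon, hmon, derivative_monomial]
    simp only [eval₂_monomial]
    rw [hD, hf]
    cases n with
    | zero =>
      have h1 : D 1 = 0 := by simpa using hD 1 1
      simp [h1]
    | succ n =>
      rw [additive_pow_of_leibniz hD]
      simp only [Nat.add_sub_cancel, map_mul, map_natCast]
      push_cast
      ring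

end Evaluation

section Generator

variable {A F L : Type*} [CommRing A] [IsDomain A] [Nonempty (NormalizedGCDMonoid A)] [Field F]
  [Algebra A F] [IsFractionRing A F] [Field L] [Algebra F L] [Algebra A L] [IsScalarTower A F L]

lemma exists_isPrimitive_generator {z : L} (hz : IsIntegral F z) :
    ∃ P : A[X], P.IsPrimitive ∧ (∀ H : A[X], aeval z H = 0 → P ∣ H) ∧
      ∃ c : F, c ≠ 0 ∧ P.map (algebraMap A F) = C c * minpoly F z := by
  obtain ⟨_⟩ := ‹Nonempty (NormalizedGCDMonoid A)›
  set μ := minpoly F z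
  have hμ : μ ≠ 0 := minpoly.ne_zero hz
  obtain ⟨b, hb, hmap⟩ := IsLocalization.integerNormalization_spec (nonZeroDivisors A) μ
  set N := IsLocalization.integerNormalization (nonZeroDivisors A) μ
  have hb0 : algebraMap A F b ≠ 0 := by
    simpa using nonZeroDivisors.ne_zero hb
  have hN : N ≠ 0 := by
    intro h0
    rw [h0, Polynomial.map_zero, Algebra.smul_def, Polynomial.algebraMap_apply] at hmap
    exact mul_ne_zero (C_ne_zero.2 hb0) hμ hmap.symm
  have hc0 : algebraMap A F N.content ≠ 0 := by
    simpa using content_eq_zero_iff.not.2 hN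
  have hP : N.primPart.map (algebraMap A F)
      = C ((algebraMap A F N.content)⁻¹ * algebraMap A F b) * μ := by
    have h1 := congrArg (Polynomial.map (algebraMap A F)) N.eq_C_content_mul_primPart
    rw [hmap, Polynomial.map_mul, map_C, Algebra.smul_def, Polynomial.algebraMap_apply] at h1
    rw [C_mul, mul_assoc, h1, ← mul_assoc, ← C_mul, inv_mul_cancel₀ hc0, C_1, one_mul]
  refine ⟨N.primPart, N.isPrimitive_primPart, fun H hH => ?_, _,
    mul_ne_zero (inv_ne_zero hc0) hb0, hP⟩
  apply N.isPrimitive_primPart.dvd_of_fraction_map_dvd_fraction_map (K := F)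
  rw [hP]
  have hdvd : μ ∣ H.map (algebraMap A F) := minpoly.dvd _ _ (by rwa [aeval_map_algebraMap])
  have hu : IsUnit (C ((algebraMap A F N.content)⁻¹ * algebraMap A F b)) :=
    isUnit_C.2 (mul_ne_zero (inv_ne_zero hc0) hb0).isUnit
  exact hu.mul_left_dvd.2 hdvd

end Generator

section Trace

variable {K F L : Type*} [Field K] [CharZero K] [Field F] [Field L] [Algebra K[X] F]
  [IsFractionRing K[X] F] [Algebra F L] [Algebra K[X] L] [IsScalarTower K[X] F L]

/-- For a solution of `y y'' = (y')² - s y y' + R(y)` with `y'` algebraic over `K(y)`, the linear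
term of the trace of `y'` over `K(y)` is determined up to an integer. -/
lemma exists_minpoly_coeff_eq {D : L →+ L} (hD : ∀ a b, D (a * b) = a * D b + D a * b)
    {d : K →+ K} (hd : ∀ a b, d (a * b) = a * d b + d a * b)
    (hDd : ∀ a, D (algebraMap K[X] L (C a)) = algebraMap K[X] L (C (d a)))
    {z : L} (hz : IsIntegral F z) (hy : D (algebraMap K[X] L X) = z)
    {s η : K} {R : K[X]} (hη : η ≠ 0) (hdη : d η = 0) (hR : R.coeff 0 = -η ^ 2)
    (hode : algebraMap K[X] L X * D z
      = z ^ 2 - algebraMap K[X] L (C s * X) * z + algebraMap K[X] L R) :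
    ∃ (M : ℤ) (T : K[X]),
      (minpoly F z).coeff ((minpoly F z).natDegree - 1) = algebraMap K[X] F T ∧
      T.coeff 1 = M * (R.coeff 1 / η) - s * (minpoly F z).natDegree := by
  obtain ⟨P, hPprim, hPgen, c, hc, hPmap⟩ := exists_isPrimitive_generator (A := K[X]) hz
  set φ := algebraMap K[X] L
  have hφ : ∀ f : K[X], D (φ f) = φ (coeffDer d f) + φ (derivY K f) * z := by
    intro f
    have hf : ∀ g : K[X], φ g = eval₂ (φ.comp C) (φ X) g := fun g => by
      rw [← hom_eval₂, eval₂_C_X]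
    rw [hf f, leibniz_eval₂ hD (φ.comp C) d 0 0 (by simpa using hDd), hy, ← hf, derivY_apply,
      ← hf (derivative f)]
    simp
  have hinv : ∀ Q : K[X][X], aeval z Q = 0 →
      aeval z (C X * coeffDer (coeffDer d) Q + C X * X * coeffDer (derivY K) Q
        + (X ^ 2 - C (C s * X) * X + C R) * derivative Q) = 0 := by
    intro Q hQ
    have h1 := leibniz_eval₂ hD φ _ _ z hφ z Q
    rw [← aeval_def, hQ, map_zero] at h1
    simp only [aeval_def, eval₂_add, eval₂_mul, eval₂_sub, eval₂_C, eval₂_X, eval₂_pow]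
    linear_combination -φ X * h1 - eval₂ φ z (derivative Q) * hode
  have hPz : aeval z P = 0 := by
    rw [← aeval_map_algebraMap F, hPmap, map_mul, minpoly.aeval, mul_zero]
  obtain ⟨G, hG⟩ := hPgen _ (hinv P hPz)
  obtain ⟨q, hq, hlead⟩ := exists_leadingCoeff_eq_C hPprim
    (natDegree_coeffDer_le _ _) (hG.trans (mul_comm _ _))
  set P' := C (C q⁻¹) * P with hP'
  have hP'm : P'.Monic := by
    rw [Monic, hP', leadingCoeff_mul, hlead, leadingCoeff_C, ← C_mul, inv_mul_cancel₀ hq, C_1]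
  have hP'map : P'.map (algebraMap K[X] F) = minpoly F z := by
    have h1 : P'.map (algebraMap K[X] F) = C (algebraMap K[X] F (C q⁻¹) * c) * minpoly F z := by
      rw [hP', Polynomial.map_mul, hPmap, map_C, C_mul, mul_assoc]
    have h2 := (hP'm.map (algebraMap K[X] F)).leadingCoeff
    rw [h1, leadingCoeff_mul, leadingCoeff_C, (minpoly.monic hz).leadingCoeff, mul_one] at h2
    rw [h1, h2, C_1, one_mul]
  have hdeg : P'.natDegree = (minpoly F z).natDegree := by
    rw [← hP'map, hP'm.natDegree_map]
  have hP'z : aeval z P' = 0 := by rw [hP', map_mul, hPz, mul_zero]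
  obtain ⟨G', hG'⟩ := hPgen _ (hinv P' hP'z)
  have hPP' : P = C (C q) * P' := by
    rw [hP', ← mul_assoc, ← C_mul, ← C_mul, mul_inv_cancel₀ hq, C_1, C_1, one_mul]
  obtain ⟨M, hM⟩ := exists_coeff_one_eq (G := G' * C (C q)) hd hP'm
    (by rw [hdeg]; exact minpoly.natDegree_pos hz) hη hdη hR
    (by rw [hG', mul_assoc, ← hPP', mul_comm])
  refine ⟨M, P'.coeff (P'.natDegree - 1), ?_, by rw [hM, hdeg]⟩
  rw [← hdeg, ← hP'map, coeff_map]

end Trace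

section Relation

open IntermediateField

variable {K L : Type*} [Field K] [CharZero K] [Field L] [Algebra K L]

lemma exists_minpoly_coeff_eq_of_transcendental {D : L →+ L}
    (hD : ∀ a b, D (a * b) = a * D b + D a * b)
    {d : K →+ K} (hd : ∀ a b, d (a * b) = a * d b + d a * b)
    (hDd : ∀ a, D (algebraMap K L a) = algebraMap K L (d a))
    {y : L} (hy : Transcendental K y) {E : IntermediateField K L} (hE : E = K⟮y⟯)
    (hz : IsIntegral E (D y)) {s η : K} {R : K[X]} (hη : η ≠ 0) (hdη : d η = 0)
    (hR : R.coeff 0 = -η ^ 2)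
    (hode : y * D (D y) = D y ^ 2 - algebraMap K L s * y * D y + aeval y R) :
    ∃ (M : ℤ) (T : K[X]),
      ((minpoly E (D y)).coeff ((minpoly E (D y)).natDegree - 1) : L) = aeval y T ∧
      T.coeff 1 = M * (R.coeff 1 / η) - s * (minpoly E (D y)).natDegree := by
  have hyE : y ∈ E := hE ▸ mem_adjoin_simple_self K y
  have hinj : Function.Injective (aeval (R := K) y) := transcendental_iff_injective.1 hy
  let : Algebra K[X] L := (aeval (R := K) y).toRingHom.toAlgebra
  let : Algebra K[X] E := (aeval (R := K) (⟨y, hyE⟩ : E)).toRingHom.toAlgebra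
  have hmapE : ∀ p : K[X], ((algebraMap K[X] E p : E) : L) = aeval y p := fun p =>
    (aeval_algebraMap_apply L (⟨y, hyE⟩ : E) p).symm
  have : IsScalarTower K[X] E L := IsScalarTower.of_algebraMap_eq fun p => (hmapE p).symm
  have : IsFractionRing K[X] E := by
    have hinjE : Function.Injective (algebraMap K[X] E) := fun p q h => hinj (by
      rw [← hmapE, ← hmapE, h])
    have : FaithfulSMul K[X] E := (faithfulSMul_iff_algebraMap_injective _ _).2 hinjE
    refine IsFractionRing.of_field K[X] E fun x => ?_
    have hx : (x : L) ∈ K⟮y⟯ := hE ▸ x.2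
    obtain ⟨r, q, hrq⟩ := (mem_adjoin_simple_iff K _).1 hx
    exact ⟨r, q, Subtype.ext (by rw [hrq, ← hmapE, ← hmapE]; rfl)⟩
  obtain ⟨M, T, h1, h2⟩ := exists_minpoly_coeff_eq (K := K) (F := E) (L := L) hD hd
    (fun a => by
      change D (aeval y (C a)) = aeval y (C (d a))
      rw [aeval_C, aeval_C, hDd]) hz
    (by change D (aeval y X) = D y; rw [aeval_X]) (s := s) (R := R) hη hdη hR
    (by
      change aeval y X * D (D y) = D y ^ 2 - aeval y (C s * X) * D y + aeval y R
      rw [aeval_X, hode, map_mul, aeval_C, aeval_X])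
  exact ⟨M, T, by rw [h1, hmapE], h2⟩

/-- The minimal polynomial of `a * u` is obtained from that of `u` by scaling the roots. -/
lemma minpoly_mul_eq_scaleRoots {E : Type*} [Field E] [Algebra E L] {a : E} (ha : a ≠ 0) {u : L}
    (hu : IsIntegral E u) :
    minpoly E (algebraMap E L a * u) = (minpoly E u).scaleRoots a := by
  have key : ∀ (b : E) (v : L),
      aeval (algebraMap E L b * v) ((minpoly E v).scaleRoots b) = 0 := fun b v =>
    scaleRoots_aeval_eq_zero (minpoly.aeval E v)
  have hau : IsIntegral E (algebraMap E L a * u) := isIntegral_algebraMap.mul hu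
  have h2 := minpoly.dvd E _ (key a u)
  have h3 : (minpoly E u).natDegree ≤ (minpoly E (algebraMap E L a * u)).natDegree := by
    have h4 := minpoly.dvd E _ (key a⁻¹ (algebraMap E L a * u))
    rw [← mul_assoc, ← map_mul, inv_mul_cancel₀ ha, map_one, one_mul] at h4
    refine (natDegree_le_of_dvd h4 ?_).trans_eq (natDegree_scaleRoots _ _)
    exact scaleRoots_ne_zero (minpoly.ne_zero hau) _
  refine (eq_of_monic_of_dvd_of_natDegree_le (minpoly.monic hau)
    ((monic_scaleRoots_iff _).2 (minpoly.monic hu)) h2 ?_).symm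
  rwa [natDegree_scaleRoots]

lemma coeff_one_eq_neg_of_aeval_inv {K L : Type*} [Field K] [Field L] [Algebra K L]
    {y : L} (hy : Transcendental K y) {T U : K[X]}
    (h : aeval y T = -y ^ 2 * aeval y⁻¹ U) : U.coeff 1 = -T.coeff 1 := by
  have hy0 : y ≠ 0 := fun h => hy (h ▸ isAlgebraic_zero)
  set N := U.natDegree + 1 with hN
  let : Invertible y⁻¹ := ⟨y, mul_inv_cancel₀ hy0, inv_mul_cancel₀ hy0⟩
  have h1 : aeval y (reflect N U) * y⁻¹ ^ N = aeval y⁻¹ U :=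
    eval₂_reflect_mul_pow (algebraMap K L) y⁻¹ N U (Nat.le_succ _)
  have h2 : T * X ^ N = -(reflect N U * X ^ 2) := by
    apply transcendental_iff_injective.1 hy
    simp only [map_mul, map_neg, map_pow, aeval_X]
    rw [h, ← h1, inv_pow]
    field_simp
  have h3 := congrArg (fun p => coeff p (1 + N)) h2
  simp only [coeff_mul_X_pow, coeff_neg] at h3
  rw [h3, hN, show 1 + (U.natDegree + 1) = U.natDegree + 2 by ring, coeff_mul_X_pow,
    coeff_reflect, revAt_le (Nat.le_succ _)]
  simp

lemma exists_int_relation {D : L →+ L}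
    (hD : ∀ a b, D (a * b) = a * D b + D a * b)
    {d : K →+ K} (hd : ∀ a b, d (a * b) = a * d b + d a * b)
    (hDd : ∀ a, D (algebraMap K L a) = algebraMap K L (d a))
    {y : L} (hy : Transcendental K y) (hz : IsAlgebraic K⟮y⟯ (D y)) {s a b c e η θ : K}
    (hη : η ≠ 0) (hdη : d η = 0) (hηe : e = -η ^ 2)
    (hθ : θ ≠ 0) (hdθ : d θ = 0) (hθc : c = θ ^ 2)
    (hode : y * D (D y) = D y ^ 2 - algebraMap K L s * y * D y +
      (algebraMap K L c * y ^ 4 + algebraMap K L a * y ^ 3 + algebraMap K L b * y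
        + algebraMap K L e)) :
    ∃ (M N : ℤ) (n : ℕ), 0 < n ∧ 2 * n * s = M * (b / η) + N * (a / θ) := by
  have hy0 : y ≠ 0 := fun h => hy (h ▸ isAlgebraic_zero)
  have hyE : y ∈ K⟮y⟯ := mem_adjoin_simple_self K y
  have hinv : K⟮y⟯ = K⟮y⁻¹⟯ := by
    apply le_antisymm
    · rw [adjoin_simple_le_iff]
      simpa using inv_mem (mem_adjoin_simple_self K y⁻¹)
    · rw [adjoin_simple_le_iff]
      exact inv_mem hyE
  set E := K⟮y⟯ with hE
  have h1 : D 1 = 0 := by simpa using hD 1 1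
  have hDinv : D y⁻¹ = -(D y / y ^ 2) := by
    have h := hD y y⁻¹
    rw [mul_inv_cancel₀ hy0, h1] at h
    field_simp
    field_simp at h
    linear_combination -h
  have hDw : D y = algebraMap E L (-⟨y, hyE⟩ ^ 2) * D y⁻¹ := by
    rw [hDinv]
    change D y = (-y ^ 2) * _
    field_simp
  have hDDw : D (D y) = -y ^ 2 * D (D y⁻¹) - 2 * y * D y * D y⁻¹ := by
    have h2 : D y + y * y * D y⁻¹ = 0 := by rw [hDinv]; field_simp; ring
    have h3 := congrArg D h2
    rw [map_add, hD, hD, map_zero] at h3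
    linear_combination h3
  have hw : IsIntegral E (D y⁻¹) := by
    rw [hDinv, show -(D y / y ^ 2) = algebraMap E L (-⟨y, hyE⟩ ^ 2)⁻¹ * D y by
      rw [map_inv₀]
      change _ = (-y ^ 2)⁻¹ * D y
      field_simp]
    exact isIntegral_algebraMap.mul hz.isIntegral
  have hyE2 : -(⟨y, hyE⟩ : E) ^ 2 ≠ 0 :=
    neg_ne_zero.2 (pow_ne_zero 2 fun h => hy0 (congrArg Subtype.val h))
  have hmin := minpoly_mul_eq_scaleRoots (a := -⟨y, hyE⟩ ^ 2) hyE2 hw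
  rw [← hDw] at hmin
  obtain ⟨M, T, hT, hT1⟩ := exists_minpoly_coeff_eq_of_transcendental hD hd hDd hy hE
    hz.isIntegral (s := s) (R := C c * X ^ 4 + C a * X ^ 3 + C b * X + C e) hη hdη
    (by simp [hηe, coeff_zero_eq_eval_zero]) (by simpa using hode)
  obtain ⟨N, U, hU, hU1⟩ := exists_minpoly_coeff_eq_of_transcendental hD hd hDd
    (y := y⁻¹) (fun h => hy (by simpa using h.inv)) hinv hw (s := s)
    (R := -(C e * X ^ 4 + C b * X ^ 3 + C a * X + C c)) hθ hdθ
    (by simp [hθc, coeff_zero_eq_eval_zero])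
    (by
      simp only [map_neg, map_add, map_mul, map_pow, aeval_C, aeval_X]
      rw [hDDw] at hode
      have h4 : D y = -y ^ 2 * D y⁻¹ := hDw
      rw [h4] at hode
      rw [inv_pow, inv_pow]
      field_simp
      simp only [one_div]
      linear_combination -hode)
  have hdeg : (minpoly E (D y)).natDegree = (minpoly E (D y⁻¹)).natDegree := by
    rw [hmin, natDegree_scaleRoots]
  have hTU : aeval y T = -y ^ 2 * aeval y⁻¹ U := by
    rw [← hT, ← hU, hmin, natDegree_scaleRoots, coeff_scaleRoots]
    have := minpoly.natDegree_pos hw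
    rw [show (minpoly E (D y⁻¹)).natDegree - ((minpoly E (D y⁻¹)).natDegree - 1) = 1 by omega]
    simp
    ring
  have hc := coeff_one_eq_neg_of_aeval_inv hy hTU
  refine ⟨M, -N, _, minpoly.natDegree_pos hw, ?_⟩
  rw [hdeg] at hT1
  rw [hT1, hU1] at hc
  simp [coeff_C] at hc
  push_cast
  linear_combination -hc

end Relation

open IntermediateField in
lemma algebraicIndependent_pair_of_transcendental {K L : Type*} [Field K] [Field L] [Algebra K L]
    {x y : L} (hx : Transcendental K x) (hy : Transcendental K⟮x⟯ y) :
    AlgebraicIndependent K ![x, y] := by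
  have h1 : AlgebraicIndependent K ![x] := algebraicIndependent_iff_transcendental.2 hx
  have h2 : Transcendental (Algebra.adjoin K (Set.range ![x])) y := by
    rw [Matrix.range_cons, Matrix.range_empty, Set.union_empty]
    exact Transcendental.of_tower_top_of_subalgebra_le (algebra_adjoin_le_adjoin K {x})
      (B := K⟮x⟯.toSubalgebra) hy
  have h3 := (h1.option_iff_transcendental y).2 h2
  have h4 := h3.comp ![some 0, none] (by decide)
  convert! h4 using 1
  ext i
  fin_cases i <;> rfl

lemma false_of_algebraicIndependent_of_relation {A : Type*} [Field A] [CharZero A] {a b c e : A}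
    (hind : AlgebraicIndependent ℚ ![a, b, c, e]) {M N : ℤ} {n : ℕ} (hn : 0 < n) {η θ : A}
    (hη : e = -η ^ 2) (hθ : c = θ ^ 2) (hη0 : η ≠ 0) (hθ0 : θ ≠ 0)
    (h : 2 * n = M * (b / η) + N * (a / θ)) : False := by
  let p : MvPolynomial (Fin 4) ℚ :=
    (M ^ 2 * .X 1 ^ 2 * .X 2 + 4 * n ^ 2 * .X 2 * .X 3 + N ^ 2 * .X 0 ^ 2 * .X 3) ^ 2
    - 16 * n ^ 2 * N ^ 2 * .X 0 ^ 2 * .X 2 * .X 3 ^ 2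
  have hp : MvPolynomial.aeval ![a, b, c, e] p = 0 := by
    simp [p]
    field_simp at h
    set P := M * b * θ
    set Q := N * a * η
    set R := 2 * n * η * θ
    rw [hη, hθ]
    linear_combination -(P + R - Q) * (P ^ 2 - R ^ 2 - Q ^ 2 - 2 * R * Q) * h
  have hp0 := (algebraicIndependent_iff.1 hind) p hp
  have h1 := congrArg (MvPolynomial.eval ![0, 0, 1, 1]) hp0
  simp [p] at h1
  omega

end Helpers

/-- Strong minimality of the generic third Painlevé equation: for `α, β, γ, δ ∈ ℂ`
algebraically independent over `ℚ`, any solution `y ≠ 0` of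
`y'' = (1/y)(y')² − (1/t)y' + (1/t)(αy² + β) + γy³ + δ/y`
is either algebraic over a differential subfield `K`, or `y, y'` are algebraically
independent over `K`. -/
theorem painleveIII_strongly_minimal
    (α β γ δ : ℂ) (hind : AlgebraicIndependent ℚ ![α, β, γ, δ])
    (L : Type*) [Field L] [Algebra ℂ L]
    (D : L → L)
    (hD_add : ∀ a b : L, D (a + b) = D a + D b)
    (hD_mul : ∀ a b : L, D (a * b) = a * D b + b * D a)
    (hD_const : ∀ c : ℂ, D (algebraMap ℂ L c) = 0)
    (t : L) (hDt : D t = 1)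
    (K : Subfield L)
    (hK_const : ∀ c : ℂ, algebraMap ℂ L c ∈ K)
    (hK_t : t ∈ K)
    (hK_D : ∀ a ∈ K, D a ∈ K)
    (y : L) (hy0 : y ≠ 0)
    (hy : D (D y) = (1 / y) * (D y) ^ 2 - (1 / t) * D y
        + (1 / t) * (algebraMap ℂ L α * y ^ 2 + algebraMap ℂ L β)
        + algebraMap ℂ L γ * y ^ 3 + algebraMap ℂ L δ / y) :
    IsAlgebraic K y ∨ AlgebraicIndependent K ![y, D y] := by
  by_contra! hcon
  obtain ⟨hyK, hyz⟩ := hcon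
  have hz : IsAlgebraic (IntermediateField.adjoin K {y}) (D y) := by
    by_contra hz
    exact hyz (algebraicIndependent_pair_of_transcendental hyK hz)
  have hD0 : D 0 = 0 := by simpa using hD_add 0 0
  have ht : t ≠ 0 := by
    rintro rfl
    exact zero_ne_one (hD0.symm.trans hDt)
  have hγ : γ ≠ 0 := hind.ne_zero 2
  have hδ : δ ≠ 0 := hind.ne_zero 3
  obtain ⟨η, hη⟩ := IsAlgClosed.exists_pow_nat_eq (-δ) two_pos
  obtain ⟨θ, hθ⟩ := IsAlgClosed.exists_pow_nat_eq γ two_pos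
  have hη0 : η ≠ 0 := by
    rintro rfl
    exact hδ (by simpa using hη)
  have hθ0 : θ ≠ 0 := by
    rintro rfl
    exact hγ (by simpa using hθ.symm)
  have : CharZero L := charZero_of_injective_algebraMap (algebraMap ℂ L).injective
  have : CharZero K := (algebraMap K L).charZero
  let ι : ℂ →+* K := (algebraMap ℂ L).codRestrict K hK_const
  let D' : L →+ L := ⟨⟨D, hD0⟩, hD_add⟩
  let d : K →+ K := ⟨⟨fun a => ⟨D a, hK_D a a.2⟩, Subtype.ext hD0⟩,
    fun a b => Subtype.ext (hD_add a b)⟩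
  have hdι : ∀ c, d (ι c) = 0 := fun c => Subtype.ext (hD_const c)
  have hD' : ∀ a b, D' (a * b) = a * D' b + D' a * b := fun a b =>
    (hD_mul a b).trans (by rw [mul_comm b]; rfl)
  let s : K := ⟨t, hK_t⟩⁻¹
  have hs : s ≠ 0 := inv_ne_zero fun h => ht (congrArg Subtype.val h)
  obtain ⟨M, N, n, hn, h⟩ := exists_int_relation (D := D') hD' (d := d)
    (fun a b => Subtype.ext (hD' a b)) (fun _ => rfl) hyK hz
    (s := s) (a := s * ι α) (b := s * ι β) (c := ι γ) (e := ι δ) (η := ι η) (θ := ι θ)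
    ((map_ne_zero ι).2 hη0) (hdι η) (by rw [← map_pow, ← map_neg, hη, neg_neg])
    ((map_ne_zero ι).2 hθ0) (hdι θ) (by rw [← map_pow, hθ])
    (by
      change y * D (D y) = D y ^ 2 - t⁻¹ * y * D y + (algebraMap ℂ L γ * y ^ 4
        + t⁻¹ * algebraMap ℂ L α * y ^ 3 + t⁻¹ * algebraMap ℂ L β * y + algebraMap ℂ L δ)
      rw [hy]
      field_simp
      ring)
  refine false_of_algebraicIndependent_of_relation hind (M := M) (N := N) hn
    (by rw [hη, neg_neg]) hθ.symm hη0 hθ0 (ι.injective (mul_left_cancel₀ hs ?_))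
  simp only [map_mul, map_add, map_div₀, map_natCast, map_intCast, map_ofNat]
  linear_combination h
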